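/- arXiv:2510.02565 — 3 statements merged into one kernel-verified Lean document; each statement's English description precedes it below -/
import Mathlib

section
/- (Faà di Bruno formula, mixed-partial partition form.) Let n ≥ 1, let g : ℝ^n → ℝ be n-times continuously differentiable and let f : ℝ → ℝ be n-times continuously differentiable. Then for every x ∈ ℝ^n, ∂ⁿ(f∘g)/∂x_1 ∂x_2 ⋯ ∂x_n (x) = Σ_{π ∈ Π} f^{(|π|)}(g(x)) · ∏_{B ∈ π} ( ∂^{|B|} g / ∏_{j∈B} ∂x_j )(x), where Π denotes the collection of all set partitions of the index set {1, …, n}, |π| is the number of blocks of the partition π, and |B| is the cardinality of the block B. -/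
/-- The mixed partial derivative of `h` taken once with respect to each coordinate
`x_j`, `j ∈ B` (an iterated Fréchet derivative evaluated on the corresponding
standard basis vectors, listed in increasing order of index). -/
noncomputable def mixedPartial {n : ℕ} (h : (Fin n → ℝ) → ℝ) (B : Finset (Fin n))
    (x : Fin n → ℝ) : ℝ :=
  iteratedFDeriv ℝ B.card h x (fun i => Pi.single ((B.orderIsoOfFin rfl i : Fin n)) 1)

namespace OrderedFinpartition

variable {n : ℕ}

/-- The `m`-th block of an ordered finpartition, as a finset. -/
def block (c : OrderedFinpartition n) (m : Fin c.length) : Finset (Fin n) :=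
  Finset.univ.image (c.emb m)

lemma coe_block (c : OrderedFinpartition n) (m : Fin c.length) :
    (c.block m : Set (Fin n)) = Set.range (c.emb m) := by
  simp [block]

lemma emb_mem_block (c : OrderedFinpartition n) (m : Fin c.length) (i : Fin (c.partSize m)) :
    c.emb m i ∈ c.block m :=
  Finset.mem_image_of_mem _ (Finset.mem_univ i)

lemma card_block (c : OrderedFinpartition n) (m : Fin c.length) :
    (c.block m).card = c.partSize m := by
  rw [block, Finset.card_image_of_injective _ (c.emb_strictMono m).injective, Finset.card_fin]

lemma eq_of_mem_block (c : OrderedFinpartition n) {m m' : Fin c.length} {j : Fin n}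
    (h : j ∈ c.block m) (h' : j ∈ c.block m') : m = m' := by
  simp only [block, Finset.mem_image, Finset.mem_univ, true_and] at h h'
  obtain ⟨i, rfl⟩ := h
  obtain ⟨i', h'⟩ := h'
  by_contra hne
  exact c.emb_ne_emb_of_ne (Ne.symm hne) h'

lemma block_nonempty (c : OrderedFinpartition n) (m : Fin c.length) : (c.block m).Nonempty :=
  ⟨_, c.emb_mem_block m ⟨0, c.partSize_pos m⟩⟩

lemma block_injective (c : OrderedFinpartition n) : Function.Injective c.block := by
  intro m m' h
  obtain ⟨j, hj⟩ := c.block_nonempty m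
  exact c.eq_of_mem_block hj (h ▸ hj)

/-- The greatest element of the `m`-th block of an ordered finpartition. -/
def top (c : OrderedFinpartition n) (m : Fin c.length) : Fin n :=
  c.emb m ⟨c.partSize m - 1, Nat.sub_one_lt_of_lt (c.partSize_pos m)⟩

lemma isGreatest_top (c : OrderedFinpartition n) (m : Fin c.length) :
    IsGreatest (c.block m : Set (Fin n)) (c.top m) := by
  refine ⟨c.emb_mem_block m _, ?_⟩
  rw [coe_block]
  rintro _ ⟨i, rfl⟩
  exact (c.emb_strictMono m).monotone (Fin.mk_le_mk.2 (Nat.le_sub_one_of_lt i.2))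

/-- The unordered partition underlying an ordered finpartition. -/
def toFinpartition (c : OrderedFinpartition n) :
    Finpartition (Finset.univ : Finset (Fin n)) where
  parts := Finset.univ.image c.block
  supIndep := by
    rw [Finset.supIndep_iff_pairwiseDisjoint]
    intro A hA B hB hAB
    simp only [Finset.coe_image, Finset.coe_univ, Set.image_univ, Set.mem_range] at hA hB
    obtain ⟨m, rfl⟩ := hA
    obtain ⟨m', rfl⟩ := hB
    refine Finset.disjoint_left.2 fun j hj hj' => hAB ?_
    rw [c.eq_of_mem_block hj hj']
  sup_parts := by
    ext j
    obtain ⟨m, i, rfl⟩ := c.cover j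
    simpa [Finset.mem_sup] using ⟨m, c.emb_mem_block m i⟩
  bot_notMem := by
    simp only [Finset.mem_image, Finset.mem_univ, true_and, not_exists]
    exact fun m => (c.block_nonempty m).ne_empty

lemma card_parts_toFinpartition (c : OrderedFinpartition n) :
    c.toFinpartition.parts.card = c.length := by
  rw [toFinpartition, Finset.card_image_of_injective _ c.block_injective, Finset.card_fin]

lemma exists_block_eq_of_parts_eq {c d : OrderedFinpartition n}
    (h : c.toFinpartition.parts = d.toFinpartition.parts) (m : Fin c.length) :
    ∃ m', d.block m' = c.block m := by
  have : c.block m ∈ d.toFinpartition.parts :=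
    h ▸ Finset.mem_image_of_mem _ (Finset.mem_univ m)
  simpa [toFinpartition] using this

lemma range_top_subset_of_parts_eq {c d : OrderedFinpartition n}
    (h : c.toFinpartition.parts = d.toFinpartition.parts) :
    Set.range c.top ⊆ Set.range d.top := by
  rintro _ ⟨m, rfl⟩
  obtain ⟨m', hm'⟩ := exists_block_eq_of_parts_eq h m
  exact ⟨m', (d.isGreatest_top m').unique (hm' ▸ c.isGreatest_top m)⟩

lemma block_eq_of_parts_eq {c d : OrderedFinpartition n}
    (h : c.toFinpartition.parts = d.toFinpartition.parts) (hl : c.length = d.length)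
    (m : Fin c.length) : c.block m = d.block (Fin.cast hl m) := by
  have htop : c.top = d.top ∘ Fin.cast hl := by
    refine (StrictMono.range_inj c.parts_strictMono
      (d.parts_strictMono.comp (Fin.cast_strictMono hl))).1 ?_
    change Set.range c.top = Set.range (d.top ∘ Fin.cast hl)
    rw [(show Function.Surjective (Fin.cast hl) from (finCongr hl).surjective).range_comp d.top]
    exact (range_top_subset_of_parts_eq h).antisymm (range_top_subset_of_parts_eq h.symm)
  obtain ⟨m', hm'⟩ := exists_block_eq_of_parts_eq h m
  have h1 : d.top (Fin.cast hl m) ∈ d.block m' := by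
    rw [hm', ← Function.comp_apply (f := d.top), ← htop]
    exact (c.isGreatest_top m).1
  rw [d.eq_of_mem_block (d.isGreatest_top _).1 h1, hm']

lemma toFinpartition_injective :
    Function.Injective (toFinpartition : OrderedFinpartition n → _) := by
  intro c d h
  have hp := congrArg Finpartition.parts h
  have hl : c.length = d.length := by
    rw [← card_parts_toFinpartition, ← card_parts_toFinpartition, h]
  have hb := block_eq_of_parts_eq hp hl
  have hs : ∀ m, c.partSize m = d.partSize (Fin.cast hl m) := fun m => by
    rw [← card_block, ← card_block, hb]
  have hr : ∀ m, Set.range (c.emb m) = Set.range (d.emb (Fin.cast hl m)) := fun m => by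
    rw [← coe_block, ← coe_block, hb]
  clear hb hp h
  obtain ⟨l, s, _, e, he, _, _, _⟩ := c
  obtain ⟨l', s', _, e', he', _, _, _⟩ := d
  dsimp only at hl
  subst hl
  obtain rfl : s = s' := funext hs
  obtain rfl : e = e' := funext fun m => ((he m).range_inj (he' m)).1 (hr m)
  rfl

end OrderedFinpartition

namespace Finpartition

variable {n : ℕ} (π : Finpartition (Finset.univ : Finset (Fin n)))

/-- The greatest elements of the parts of a partition of `Fin n`. -/
def tops : Finset (Fin n) :=
  Finset.univ.filter fun j => ∀ i ∈ π.part j, i ≤ j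

lemma le_of_mem_tops {i j : Fin n} (hj : j ∈ π.tops) (hi : i ∈ π.part j) : i ≤ j :=
  (Finset.mem_filter.1 hj).2 i hi

lemma eq_of_part_eq_of_mem_tops {i j : Fin n} (hi : i ∈ π.tops) (hj : j ∈ π.tops)
    (h : π.part i = π.part j) : i = j :=
  le_antisymm (π.le_of_mem_tops hj (h ▸ π.mem_part (Finset.mem_univ i)))
    (π.le_of_mem_tops hi (h ▸ π.mem_part (Finset.mem_univ j)))

lemma exists_mem_tops_part_eq {B : Finset (Fin n)} (hB : B ∈ π.parts) :
    ∃ j ∈ π.tops, π.part j = B := by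
  have hne := π.nonempty_of_mem_parts hB
  have hpart := π.part_eq_of_mem hB (B.max'_mem hne)
  refine ⟨B.max' hne, Finset.mem_filter.2 ⟨Finset.mem_univ _, fun i hi => ?_⟩, hpart⟩
  exact B.le_max' i (hpart ▸ hi)

lemma card_part_pos (j : Fin n) : 0 < (π.part j).card :=
  Finset.card_pos.2 ⟨j, π.mem_part (Finset.mem_univ j)⟩

/-- A partition of `Fin n` with its parts listed by increasing greatest element. -/
def toOrderedFinpartition : OrderedFinpartition n where
  length := π.tops.card
  partSize m := (π.part (π.tops.orderEmbOfFin rfl m)).card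
  partSize_pos _ := π.card_part_pos _
  emb m := (π.part (π.tops.orderEmbOfFin rfl m)).orderEmbOfFin rfl
  emb_strictMono m := OrderEmbedding.strictMono _
  parts_strictMono := by
    convert (π.tops.orderEmbOfFin rfl).strictMono using 2 with m
    rw [Finset.orderEmbOfFin_last rfl (π.card_part_pos _)]
    have hm := π.tops.orderEmbOfFin_mem rfl m
    exact le_antisymm (Finset.max'_le _ _ _ fun i hi => π.le_of_mem_tops hm hi)
      (Finset.le_max' _ _ (π.mem_part (Finset.mem_univ _)))
  disjoint := by
    intro m _ m' _ hne
    simp only [Function.onFun, Finset.range_orderEmbOfFin, Finset.disjoint_coe]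
    refine π.disjoint (π.part_mem.2 (Finset.mem_univ _)) (π.part_mem.2 (Finset.mem_univ _))
      fun h => hne ?_
    exact (π.tops.orderEmbOfFin rfl).injective <| π.eq_of_part_eq_of_mem_tops
      (π.tops.orderEmbOfFin_mem rfl m) (π.tops.orderEmbOfFin_mem rfl m') h
  cover x := by
    obtain ⟨j, hj, hjx⟩ := π.exists_mem_tops_part_eq (π.part_mem.2 (Finset.mem_univ x))
    obtain ⟨m, rfl⟩ : j ∈ Set.range (π.tops.orderEmbOfFin rfl) := by simpa using hj
    refine ⟨m, ?_⟩
    rw [Finset.range_orderEmbOfFin, hjx]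
    exact π.mem_part (Finset.mem_univ x)

lemma block_toOrderedFinpartition (m : Fin π.toOrderedFinpartition.length) :
    π.toOrderedFinpartition.block m = π.part (π.tops.orderEmbOfFin rfl m) := by
  rw [← Finset.coe_inj, OrderedFinpartition.coe_block]
  exact Finset.range_orderEmbOfFin _ _

lemma toFinpartition_toOrderedFinpartition :
    π.toOrderedFinpartition.toFinpartition = π := by
  ext B : 2
  simp only [OrderedFinpartition.toFinpartition, Finset.mem_image, Finset.mem_univ, true_and]
  constructor
  · rintro ⟨m, rfl⟩
    rw [π.block_toOrderedFinpartition m]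
    exact π.part_mem.2 (Finset.mem_univ _)
  · intro hB
    obtain ⟨j, hj, rfl⟩ := π.exists_mem_tops_part_eq hB
    obtain ⟨m, rfl⟩ : j ∈ Set.range (π.tops.orderEmbOfFin rfl) := by simpa using hj
    exact ⟨m, π.block_toOrderedFinpartition m⟩

end Finpartition

lemma OrderedFinpartition.toFinpartition_bijective {n : ℕ} :
    Function.Bijective (toFinpartition : OrderedFinpartition n → _) :=
  ⟨toFinpartition_injective, fun π => ⟨_, π.toFinpartition_toOrderedFinpartition⟩⟩

/-- A mixed partial derivative may be computed with any increasing enumeration of the set of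
coordinates. -/
lemma mixedPartial_eq_of_strictMono {n k : ℕ} (h : (Fin n → ℝ) → ℝ) {B : Finset (Fin n)}
    (x : Fin n → ℝ) (hk : B.card = k) {e : Fin k → Fin n} (he : StrictMono e)
    (hB : ∀ i, e i ∈ B) :
    mixedPartial h B x = iteratedFDeriv ℝ k h x fun i => Pi.single (e i) 1 := by
  subst hk
  rw [Finset.orderEmbOfFin_unique rfl hB he]
  rfl

/-- **Faà di Bruno formula, mixed-partial partition form.** For `g : ℝⁿ → ℝ` and
`f : ℝ → ℝ` both `n`-times continuously differentiable,
`∂ⁿ(f∘g)/∂x_1⋯∂x_n (x) = Σ_{π} f^{(|π|)}(g(x)) ∏_{B ∈ π} ∂^{|B|}g/∏_{j∈B}∂x_j (x)`,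
the sum being over all set partitions `π` of `{1,…,n}`. -/
theorem stmt3 {n : ℕ} (hn : 1 ≤ n) (g : (Fin n → ℝ) → ℝ) (f : ℝ → ℝ)
    (hg : ContDiff ℝ n g) (hf : ContDiff ℝ n f) (x : Fin n → ℝ) :
    mixedPartial (f ∘ g) Finset.univ x =
      ∑ π : Finpartition (Finset.univ : Finset (Fin n)),
        iteratedDeriv π.parts.card f (g x) * ∏ B ∈ π.parts, mixedPartial g B x := by
  rw [mixedPartial_eq_of_strictMono (f ∘ g) x (Finset.card_fin n) strictMono_id
    fun _ => Finset.mem_univ _, iteratedFDeriv_comp hf.contDiffAt hg.contDiffAt le_rfl,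
    FormalMultilinearSeries.taylorComp, sum_apply]
  refine Fintype.sum_bijective _ OrderedFinpartition.toFinpartition_bijective _ _ fun c => ?_
  rw [FormalMultilinearSeries.compAlongOrderedFinpartition_apply, c.card_parts_toFinpartition,
    ftaylorSeries, iteratedFDeriv_apply_eq_iteratedDeriv_mul_prod, smul_eq_mul, mul_comm,
    OrderedFinpartition.toFinpartition, Finset.prod_image c.block_injective.injOn]
  congr 1
  refine Finset.prod_congr rfl fun m _ => ?_
  rw [mixedPartial_eq_of_strictMono g x (c.card_block m) (c.emb_strictMono m) (c.emb_mem_block m)]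
  rfl
end

section
/- Let g : ℝ^n → ℝ^m be a map each of whose components admits, at every point, a power series expansion with infinite radius of convergence, and let f : ℝ^m → ℝ admit, at every point, a power series expansion with infinite radius of convergence. Then the composition f ∘ g : ℝ^n → ℝ admits, at every point of ℝ^n, a power series expansion with infinite radius of convergence. -/
open scoped ENNReal NNReal Topology

section

variable {𝕜 E F G : Type*} [NontriviallyNormedField 𝕜]
  [NormedAddCommGroup E] [NormedSpace 𝕜 E] [NormedAddCommGroup F] [NormedSpace 𝕜 F]
  [NormedAddCommGroup G] [NormedSpace 𝕜 G]

/-- If `ρ` bounds the sum of the norms of the non-constant terms of `p` on the ball of radius `r`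
and `ρ` is less than the radius of convergence of `q`, then the terms of `q.comp p` are
absolutely summable on the ball of radius `r`. -/
theorem FormalMultilinearSeries.summable_compAlongComposition_of_sum_le
    (q : FormalMultilinearSeries 𝕜 F G) (p : FormalMultilinearSeries 𝕜 E F) {r ρ : ℝ≥0}
    (hp : ∀ N, ∑ i ∈ Finset.Ico 1 N, ‖p i‖₊ * r ^ i ≤ ρ) (hq : (ρ : ℝ≥0∞) < q.radius) :
    Summable fun i : Σ n, Composition n => ‖q.compAlongComposition p i.2‖₊ * r ^ i.1 := by
  have hsum := q.summable_nnnorm_mul_pow hq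
  have hle : ∀ i : Σ n, Composition n, ‖q.compAlongComposition p i.2‖₊ * r ^ i.1 ≤
      ‖q i.2.length‖₊ * ∏ j, (‖p (i.2.blocksFun j)‖₊ * r ^ i.2.blocksFun j) := by
    rintro ⟨n, c⟩
    calc
      _ ≤ (‖q c.length‖₊ * ∏ j, ‖p (c.blocksFun j)‖₊) * r ^ n := by
        grw [q.compAlongComposition_nnnorm p c]
      _ = _ := by
        simp only [Finset.prod_mul_distrib, Finset.prod_pow_eq_pow_sum, c.sum_blocksFun, mul_assoc]
  refine NNReal.summable_of_le hle ?_
  refine NNReal.summable_coe.1 (summable_of_sum_le (c := (∑' k, ‖q k‖₊ * ρ ^ k : ℝ≥0))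
    (fun i => NNReal.coe_nonneg _) fun s => ?_)
  rw [← NNReal.coe_sum, NNReal.coe_le_coe]
  obtain ⟨N, hN⟩ := (compPartialSumTarget_tendsto_atTop.eventually_ge_atTop s).exists
  refine (Finset.sum_le_sum_of_subset hN).trans ?_
  rw [← compChangeOfVariables_sum 0 N N
    (fun e => ‖q e.1‖₊ * ∏ j, (‖p (e.2 j)‖₊ * r ^ e.2 j))]
  · rw [compPartialSumSource, Finset.sum_sigma]
    refine le_trans (Finset.sum_le_sum fun k _ => ?_) (hsum.sum_le_tsum _ fun _ _ => zero_le)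
    have hpow : ∑ b ∈ Fintype.piFinset fun _ : Fin k => Finset.Ico 1 N,
        ∏ j, (‖p (b j)‖₊ * r ^ b j) ≤ ρ ^ k := by
      refine (Finset.sum_prod_piFinset (Finset.Ico 1 N)
        (fun _ : Fin k => fun i => ‖p i‖₊ * r ^ i)).trans_le ?_
      rw [Finset.prod_const, Finset.card_univ, Fintype.card_fin]
      gcongr
      exact hp N
    calc
      _ = ‖q k‖₊ * ∑ b ∈ Fintype.piFinset fun _ : Fin k => Finset.Ico 1 N,
          ∏ j, (‖p (b j)‖₊ * r ^ b j) := (Finset.mul_sum _ _ _).symm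
      _ ≤ _ := by gcongr
  · rintro ⟨k, b⟩ he
    have hk := compChangeOfVariables_length 0 N N he
    congr 1
    · rw [hk]
    · refine Fintype.prod_equiv (finCongr hk.symm) _ _ fun j => ?_
      exact congrArg (fun i => ‖p i‖₊ * r ^ i) (compChangeOfVariables_blocksFun 0 N N he j).symm

theorem FormalMultilinearSeries.comp_radius_eq_top {q : FormalMultilinearSeries 𝕜 F G}
    {p : FormalMultilinearSeries 𝕜 E F} (hq : q.radius = ⊤) (hp : p.radius = ⊤) :
    (q.comp p).radius = ⊤ := by
  refine ENNReal.eq_top_of_forall_nnreal_le fun r => q.le_comp_radius_of_summable p r ?_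
  have hsum : Summable fun n => ‖p n‖₊ * r ^ n :=
    p.summable_nnnorm_mul_pow (by simp [hp])
  exact q.summable_compAlongComposition_of_sum_le p
    (fun N => hsum.sum_le_tsum _ fun _ _ => zero_le) (by simp [hq])

end

/-- Two power series that converge everywhere can be composed into a power series that converges
everywhere, over `ℝ` or `ℂ`. -/
theorem HasFPowerSeriesOnBall.comp_top {𝕜 E F G : Type*} [RCLike 𝕜]
    [NormedAddCommGroup E] [NormedSpace 𝕜 E] [NormedAddCommGroup F] [NormedSpace 𝕜 F]
    [CompleteSpace F] [NormedAddCommGroup G] [NormedSpace 𝕜 G] [CompleteSpace G]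
    {f : F → G} {g : E → F} {q : FormalMultilinearSeries 𝕜 F G}
    {p : FormalMultilinearSeries 𝕜 E F} {x : E}
    (hf : HasFPowerSeriesOnBall f q (g x) ⊤) (hg : HasFPowerSeriesOnBall g p x ⊤) :
    HasFPowerSeriesOnBall (f ∘ g) (q.comp p) x ⊤ := by
  have hrad : (q.comp p).radius = ⊤ :=
    FormalMultilinearSeries.comp_radius_eq_top (top_le_iff.1 hf.r_le) (top_le_iff.1 hg.r_le)
  have hsum : HasFPowerSeriesOnBall (fun z => (q.comp p).sum (z - x)) (q.comp p) x ⊤ := by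
    have h := ((q.comp p).hasFPowerSeriesOnBall (by simp [hrad])).comp_sub x
    rwa [zero_add, hrad] at h
  obtain ⟨r, hr⟩ := hf.hasFPowerSeriesAt.comp hg.hasFPowerSeriesAt
  have hloc : (fun z => (q.comp p).sum (z - x)) =ᶠ[𝓝 x] f ∘ g :=
    Filter.eventuallyEq_of_mem (Metric.eball_mem_nhds x hr.r_pos)
      ((hsum.mono hr.r_pos le_top).unique hr)
  have hfa : AnalyticOnNhd 𝕜 f Set.univ := by simpa using hf.analyticOnNhd
  have hga : AnalyticOnNhd 𝕜 g Set.univ := by simpa using hg.analyticOnNhd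
  have hsa : AnalyticOnNhd 𝕜 (fun z => (q.comp p).sum (z - x)) Set.univ := by
    simpa using hsum.analyticOnNhd
  let : NormedSpace ℝ E := NormedSpace.restrictScalars ℝ 𝕜 E
  have heq := hsa.eq_of_eventuallyEq (hfa.comp hga (Set.mapsTo_univ _ _)) hloc
  rwa [heq] at hsum

/-- **Composition of functions which admit everywhere-convergent power series at
every point again admits an everywhere-convergent power series at every point.** -/
theorem stmt8 {n m : ℕ} (g : (Fin n → ℝ) → (Fin m → ℝ)) (f : (Fin m → ℝ) → ℝ)
    (hg : ∀ (i : Fin m) (x : Fin n → ℝ),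
      ∃ p : FormalMultilinearSeries ℝ (Fin n → ℝ) ℝ,
        HasFPowerSeriesOnBall (fun y => g y i) p x ⊤)
    (hf : ∀ x : Fin m → ℝ,
      ∃ p : FormalMultilinearSeries ℝ (Fin m → ℝ) ℝ, HasFPowerSeriesOnBall f p x ⊤) :
    ∀ x : Fin n → ℝ,
      ∃ p : FormalMultilinearSeries ℝ (Fin n → ℝ) ℝ,
        HasFPowerSeriesOnBall (f ∘ g) p x ⊤ := by
  intro x
  choose p hp using fun i => hg i x
  obtain ⟨q, hq⟩ := hf (g x)
  exact ⟨_, hq.comp_top (HasFPowerSeriesOnBall.pi hp ENNReal.zero_lt_top)⟩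
end

section
/- (One-step growth of dependence sets.) Let G be a finite simple graph on vertex set V. For a map K on node-feature assignments and a vertex v, call a vertex u relevant for K at v if there exist node-feature assignments X, X' that agree at every vertex except possibly u and satisfy K(X)_v ≠ K(X')_v; write Rel_K(v) for the set of such vertices. Let F : (V → ℝ^b) → (V → ℝ^c) be 1-local with respect to G and let H : (V → ℝ^a) → (V → ℝ^b) be arbitrary. Then Rel_{F∘H}(v) ⊆ ∪_{w ∈ N[v]} Rel_H(w); consequently |Rel_{F∘H}(v)| ≤ Σ_{w ∈ N[v]} |Rel_H(w)| ≤ (deg(v) + 1) · max_{w ∈ N[v]} |Rel_H(w)|. -/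
/-- A map `F` between node-feature assignments is 1-local with respect to `G` if the
output feature at `v` depends only on the input features on the closed
neighborhood `N[v] = {v} ∪ N(v)`. -/
def OneLocal {V : Type*} (G : SimpleGraph V) {A B : Type*}
    (F : (V → A) → (V → B)) : Prop :=
  ∀ (v : V) (X X' : V → A), (∀ u : V, (u = v ∨ G.Adj v u) → X u = X' u) → F X v = F X' v

/-- `RelSet K v` is the set of vertices `u` that are relevant for `K` at `v`: changing
the input feature of `u` alone can change the output of `K` at `v`. -/
def RelSet {V A B : Type*} (K : (V → A) → (V → B)) (v : V) : Set V :=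
  {u | ∃ X X' : V → A, (∀ w : V, w ≠ u → X w = X' w) ∧ K X v ≠ K X' v}

/-- The relevant set of a 1-local map composed with `H` lies in the union of the relevant
sets of `H` over the closed neighborhood. -/
theorem OneLocal.relSet_comp_subset {V : Type*} {G : SimpleGraph V} {A B C : Type*}
    {F : (V → B) → (V → C)} (hF : OneLocal G F) (H : (V → A) → (V → B)) (v : V) :
    RelSet (F ∘ H) v ⊆ {u | ∃ w, (w = v ∨ G.Adj v w) ∧ u ∈ RelSet H w} := by
  rintro u ⟨X, X', hX, hne⟩
  by_contra hu
  refine hne (hF v (H X) (H X') fun w hw => ?_)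
  by_contra hHw
  exact hu ⟨w, hw, X, X', hX, hHw⟩

/-- **One-step growth of dependence sets: post-composing with a 1-local map `F`
keeps the relevant set of `F ∘ H` at `v` inside the union of the relevant sets of
`H` over the closed neighborhood `N[v]`, with the corresponding cardinality
bounds.** -/
theorem stmt14 {V : Type*} [Fintype V] [DecidableEq V]
    (G : SimpleGraph V) [DecidableRel G.Adj] {a b c : ℕ}
    (F : (V → Fin b → ℝ) → (V → Fin c → ℝ))
    (H : (V → Fin a → ℝ) → (V → Fin b → ℝ))
    (hF : OneLocal G F) (v : V) :
    (RelSet (F ∘ H) v ⊆ ⋃ w ∈ insert v (G.neighborFinset v), RelSet H w) ∧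
    ((RelSet (F ∘ H) v).ncard ≤ ∑ w ∈ insert v (G.neighborFinset v), (RelSet H w).ncard) ∧
    (∑ w ∈ insert v (G.neighborFinset v), (RelSet H w).ncard ≤
      (G.degree v + 1) * (insert v (G.neighborFinset v)).sup (fun w => (RelSet H w).ncard)) := by
  have hsub : RelSet (F ∘ H) v ⊆ ⋃ w ∈ insert v (G.neighborFinset v), RelSet H w := by
    intro u hu
    obtain ⟨w, hw, huw⟩ := hF.relSet_comp_subset H v hu
    exact Set.mem_biUnion (show w ∈ (↑(insert v (G.neighborFinset v)) : Set V) by simpa using hw) huw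
  refine ⟨hsub, ?_, ?_⟩
  · exact (Set.ncard_le_ncard hsub (Set.toFinite _)).trans (Finset.set_ncard_biUnion_le _ _)
  · have hcard : (insert v (G.neighborFinset v)).card = G.degree v + 1 := by
      rw [Finset.card_insert_of_notMem (by simp), G.card_neighborFinset_eq_degree]
    rw [← hcard, ← smul_eq_mul]
    exact Finset.sum_le_card_nsmul _ _ _ fun w hw =>
      Finset.le_sup (f := fun w => (RelSet H w).ncard) hw
end
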